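/- Let H be a separable real Hilbert space and let Q be a Borel probability measure on H satisfying H1 such that x ↦ ‖∫_H g_x dQ‖ has a unique minimizer θ(Q). Then the deepest-point functional is weakly continuous at Q: for every ε > 0 there exists δ > 0 such that for every Borel probability measure Q' on H that satisfies H1 and for which x ↦ ‖∫_H g_x dQ'‖ has a unique minimizer θ(Q'), if the Lévy–Prokhorov distance between Q and Q' is less than δ, then ‖θ(Q') − θ(Q)‖ < ε. -/

import Mathlib

open MeasureTheory Filter Topology

/-- The direction function `g_x(z) = (z - x)/‖z - x‖` (with `g_x(x) = 0`). -/
noncomputable def gdir {H : Type*} [NormedAddCommGroup H] [InnerProductSpace ℝ H]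
    (x z : H) : H := ‖z - x‖⁻¹ • (z - x)

open scoped RealInnerProductSpace

section LevyProkhorov

variable {Ω : Type*} [MeasurableSpace Ω] [PseudoMetricSpace Ω] [OpensMeasurableSpace Ω]

/-- Integrals of nonnegative bounded Lipschitz functions are controlled by the Lévy–Prokhorov
distance. -/
theorem integral_le_integral_add_of_levyProkhorovDist_lt (μ ν : Measure Ω)
    [IsProbabilityMeasure μ] [IsProbabilityMeasure ν] {δ K M : ℝ} (hK : 0 ≤ K)
    (hδ : levyProkhorovDist μ ν < δ) (f : Ω → ℝ) (hf0 : ∀ x, 0 ≤ f x) (hfM : ∀ x, f x ≤ M)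
    (hfc : Continuous f) (hfK : ∀ x y, f x ≤ f y + K * dist x y) :
    ∫ x, f x ∂μ ≤ ∫ x, f x ∂ν + (K + M) * δ := by
  have hδ0 : 0 < δ := lt_of_le_of_lt ENNReal.toReal_nonneg hδ
  obtain ⟨x₀⟩ : Nonempty Ω := μ.nonempty_of_neZero
  have hM : 0 ≤ M := (hf0 x₀).trans (hfM x₀)
  have hnorm : ∀ x, ‖f x‖ ≤ M := fun x => by
    rw [Real.norm_of_nonneg (hf0 x)]; exact hfM x
  let F : BoundedContinuousFunction Ω ℝ :=
    BoundedContinuousFunction.ofNormedAddCommGroup f hfc M hnorm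
  have hFM : ‖F‖ ≤ M := BoundedContinuousFunction.norm_ofNormedAddCommGroup_le hfc hM hnorm
  have hE : levyProkhorovEDist μ ν < ENNReal.ofReal δ :=
    (ENNReal.lt_ofReal_iff_toReal_lt (levyProkhorovEDist_ne_top μ ν)).2 hδ
  have hle := F.integral_le_of_levyProkhorovEDist_lt μ ν hδ0 hE (Eventually.of_forall hf0)
  have hintegrable : Integrable (fun x => f x + K * δ) ν :=
    (F.integrable ν).add (integrable_const _)
  have hlayer := hintegrable.integral_eq_integral_Ioc_meas_le (M := ‖F‖ + K * δ)
    (Eventually.of_forall fun x => add_nonneg (hf0 x) (by positivity))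
    (Eventually.of_forall fun x => by
      have := F.norm_coe_le_norm x
      have h2 : F x = f x := rfl
      rw [h2, Real.norm_of_nonneg (hf0 x)] at this
      simpa using this)
  have hsum : ∫ x, (f x + K * δ) ∂ν = ∫ x, f x ∂ν + K * δ := by
    have hfint : Integrable f ν := F.integrable ν
    rw [integral_add hfint (integrable_const _)]
    simp
  have hanti : Antitone fun t : ℝ => ν.real {x | t ≤ f x + K * δ} :=
    fun s t hst => measureReal_mono fun x hx => le_trans hst hx
  have hion : ∀ b : ℝ, IntegrableOn (fun t : ℝ => ν.real {x | t ≤ f x + K * δ}) (Set.Ioc 0 b) :=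
    fun b => (hanti.locallyIntegrable.integrableOn_isCompact isCompact_Icc).mono_set
      Set.Ioc_subset_Icc_self
  have hthick : ∫ t in Set.Ioc 0 ‖F‖, ν.real (Metric.thickening δ {a | t ≤ F a}) ≤
      ∫ t in Set.Ioc 0 (‖F‖ + K * δ), ν.real {x | t ≤ f x + K * δ} := by
    calc _ ≤ ∫ t in Set.Ioc 0 ‖F‖, ν.real {x | t ≤ f x + K * δ} := by
          refine integral_mono_of_nonneg (Eventually.of_forall fun t => measureReal_nonneg)
            (hion _) (Eventually.of_forall fun t => measureReal_mono fun x hx => ?_)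
          obtain ⟨y, hy, hxy⟩ := Metric.mem_thickening_iff.1 hx
          have h1 : t ≤ f y := hy
          have h2 := hfK y x
          rw [dist_comm] at h2
          have h3 : K * dist x y ≤ K * δ := by gcongr
          change t ≤ f x + K * δ
          linarith
      _ ≤ _ := by
          refine setIntegral_mono_set (hion _) (Eventually.of_forall fun t => measureReal_nonneg)
            (Set.Ioc_subset_Ioc_right ?_).eventuallyLE
          have : 0 ≤ K * δ := by positivity
          linarith
  have hFδ : δ * ‖F‖ ≤ δ * M := by gcongr
  have h0 : ∫ x, F x ∂μ = ∫ x, f x ∂μ := rfl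
  rw [h0] at hle
  linarith [hlayer, hsum]

end LevyProkhorov

theorem abs_norm_sub_sub_norm_sub_le {H : Type*} [NormedAddCommGroup H] (x y z : H) :
    |‖z - x‖ - ‖z - y‖| ≤ ‖x - y‖ := by
  have := abs_norm_sub_norm_le (z - x) (z - y)
  rwa [sub_sub_sub_cancel_left, norm_sub_rev y x] at this

theorem measure_singleton_eq_zero_of_measure_sphere {H : Type*} [NormedAddCommGroup H]
    [Nontrivial H] [MeasurableSpace H] {μ : Measure H}
    (hμ : ∀ (y : H) (r : ℝ), 0 < r → μ {z | ‖z - y‖ = r} = 0) (x : H) :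
    μ {x} = 0 := by
  obtain ⟨v, hv⟩ := exists_ne (0 : H)
  refine measure_mono_null ?_ (hμ (x + v) ‖v‖ (norm_pos_iff.2 hv))
  rintro _ rfl
  simp

section Direction

variable {H : Type*} [NormedAddCommGroup H] [InnerProductSpace ℝ H]

/-- A bounded sequence in a separable Hilbert space has a weakly convergent subsequence. -/
theorem exists_subseq_tendsto_inner [CompleteSpace H] [SecondCountableTopology H] {x : ℕ → H}
    {R : ℝ} (hx : ∀ n, ‖x n‖ ≤ R) :
    ∃ (a : H) (φ : ℕ → ℕ), StrictMono φ ∧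
      ∀ y, Tendsto (fun n => ⟪x (φ n), y⟫) atTop (𝓝 ⟪a, y⟫) := by
  obtain ⟨l, -, φ, hφ, hl⟩ := WeakDual.isSeqCompact_closedBall ℝ H 0 R
    (x := fun n => StrongDual.toWeakDual (InnerProductSpace.toDual ℝ H (x n)))
    (fun n => by simpa using hx n)
  refine ⟨(InnerProductSpace.toDual ℝ H).symm (WeakDual.toStrongDual l), φ, hφ, fun y => ?_⟩
  have h := ((WeakDual.eval_continuous y).tendsto l).comp hl
  rw [InnerProductSpace.toDual_symm_apply]
  exact h

theorem inner_gdir_self (x z : H) : ⟪gdir x z, z - x⟫ = ‖z - x‖ := by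
  rw [gdir, real_inner_smul_left, real_inner_self_eq_norm_sq]
  rcases eq_or_ne ‖z - x‖ 0 with h | h
  · simp [h]
  · field_simp

theorem norm_gdir_le (x z : H) : ‖gdir x z‖ ≤ 1 := by
  rw [gdir, norm_smul, norm_inv, norm_norm]
  exact inv_mul_le_one

/-- The subgradient inequality for the distance to `z`. -/
theorem norm_sub_le_norm_sub_add_inner_gdir (x y z : H) :
    ‖z - x‖ ≤ ‖z - y‖ + ⟪gdir x z, y - x⟫ := by
  have h1 : ⟪gdir x z, z - y⟫ ≤ ‖z - y‖ :=
    (real_inner_le_norm _ _).trans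
      (mul_le_of_le_one_left (norm_nonneg _) (norm_gdir_le x z))
  have h2 : ⟪gdir x z, z - x⟫ = ⟪gdir x z, z - y⟫ + ⟪gdir x z, y - x⟫ := by
    rw [← inner_add_right]; congr 1; abel
  linarith [inner_gdir_self x z]

theorem continuousAt_gdir {x z : H} (h : z ≠ x) : ContinuousAt (fun y => gdir y z) x := by
  unfold gdir
  have h0 : ‖z - x‖ ≠ 0 := norm_ne_zero_iff.2 (sub_ne_zero.2 h)
  fun_prop (disch := exact h0)

end Direction

section Median

variable {H : Type*} [NormedAddCommGroup H] [InnerProductSpace ℝ H]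
  [MeasurableSpace H] [BorelSpace H]

/-- The (recentred) expected distance, whose minimizers are the spatial medians of `μ`. -/
noncomputable def expectedDist (μ : Measure H) (x : H) : ℝ := ∫ z, (‖z - x‖ - ‖z‖) ∂μ

variable [SecondCountableTopology H] (μ : Measure H) [IsProbabilityMeasure μ]

theorem integrable_norm_sub_sub_norm_sub (x y : H) :
    Integrable (fun z => ‖z - x‖ - ‖z - y‖) μ :=
  Integrable.of_bound (by fun_prop) ‖x - y‖
    (Eventually.of_forall fun z => abs_norm_sub_sub_norm_sub_le x y z)

theorem expectedDist_sub (x y : H) :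
    expectedDist μ x - expectedDist μ y = ∫ z, (‖z - x‖ - ‖z - y‖) ∂μ := by
  have h : ∀ x : H, Integrable (fun z => ‖z - x‖ - ‖z‖) μ := fun x => by
    simpa using integrable_norm_sub_sub_norm_sub μ x 0
  rw [expectedDist, expectedDist, ← integral_sub (h x) (h y)]
  simp

theorem measurable_gdir (x : H) : Measurable (gdir x) := by
  unfold gdir
  fun_prop

theorem integrable_gdir (x : H) : Integrable (gdir x) μ :=
  Integrable.of_bound (measurable_gdir x).aestronglyMeasurable 1
    (Eventually.of_forall fun z => norm_gdir_le x z)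

theorem integral_inner_gdir [CompleteSpace H] (x v : H) :
    ∫ z, ⟪gdir x z, v⟫ ∂μ = ⟪∫ z, gdir x z ∂μ, v⟫ := by
  simp_rw [real_inner_comm v]
  exact integral_inner (integrable_gdir μ x) v

theorem expectedDist_le_add_inner [CompleteSpace H] (x y : H) :
    expectedDist μ x ≤ expectedDist μ y + ⟪∫ z, gdir x z ∂μ, y - x⟫ := by
  have h : expectedDist μ x - expectedDist μ y ≤ ⟪∫ z, gdir x z ∂μ, y - x⟫ := by
    rw [expectedDist_sub, ← integral_inner_gdir]
    refine integral_mono (integrable_norm_sub_sub_norm_sub μ x y)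
      ((integrable_gdir μ x).inner_const _) fun z => ?_
    have := norm_sub_le_norm_sub_add_inner_gdir x y z
    change ‖z - x‖ - ‖z - y‖ ≤ ⟪gdir x z, y - x⟫
    linarith
  linarith

theorem expectedDist_lineMap_le (x y : H) {t : ℝ} (h0 : 0 ≤ t) (h1 : t ≤ 1) :
    expectedDist μ (x + t • (y - x)) - expectedDist μ x ≤
      t * (expectedDist μ y - expectedDist μ x) := by
  rw [expectedDist_sub, expectedDist_sub, ← integral_const_mul]
  refine integral_mono (integrable_norm_sub_sub_norm_sub μ _ _)
    ((integrable_norm_sub_sub_norm_sub μ _ _).const_mul _) fun z => ?_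
  change ‖z - (x + t • (y - x))‖ - ‖z - x‖ ≤ t * (‖z - y‖ - ‖z - x‖)
  have h : z - (x + t • (y - x)) = (1 - t) • (z - x) + t • (z - y) := by module
  have h2 := norm_add_le ((1 - t) • (z - x)) (t • (z - y))
  rw [norm_smul, norm_smul, Real.norm_of_nonneg h0, Real.norm_of_nonneg (sub_nonneg.2 h1)] at h2
  rw [h]
  linarith

/-- If `μ` has no atom at `x`, the mean direction vanishes at a minimizer `x` of the expected
distance. -/
theorem integral_gdir_eq_zero_of_forall_expectedDist_le [CompleteSpace H] {x : H}
    (hx : μ {x} = 0) (hmin : ∀ y, expectedDist μ x ≤ expectedDist μ y) :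
    ∫ z, gdir x z ∂μ = 0 := by
  have hcont : ContinuousAt (fun y => ∫ z, gdir y z ∂μ) x := by
    refine continuousAt_of_dominated (bound := fun _ => 1)
      (Eventually.of_forall fun y => (measurable_gdir y).aestronglyMeasurable)
      (Eventually.of_forall fun y => Eventually.of_forall fun z => norm_gdir_le y z)
      (integrable_const _) ?_
    have : ∀ᵐ z ∂μ, z ∉ ({x} : Set H) := measure_eq_zero_iff_ae_notMem.1 hx
    filter_upwards [this] with z hz
    exact continuousAt_gdir hz
  set v := ∫ z, gdir x z ∂μ with hv
  have hline : Tendsto (fun t : ℝ => x + t • v) (𝓝[>] 0) (𝓝 x) := by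
    have : Continuous fun t : ℝ => x + t • v := by fun_prop
    simpa using (this.tendsto 0).mono_left nhdsWithin_le_nhds
  have hlim : Tendsto (fun t : ℝ => ⟪∫ z, gdir (x + t • v) z ∂μ, v⟫) (𝓝[>] 0) (𝓝 ⟪v, v⟫) :=
    (hcont.tendsto.comp hline).inner tendsto_const_nhds
  have hle : ⟪v, v⟫ ≤ 0 := by
    refine le_of_tendsto hlim ?_
    filter_upwards [self_mem_nhdsWithin] with t ht
    have ht : 0 < t := ht
    have h1 := expectedDist_le_add_inner μ (x + t • v) x
    have h2 := hmin (x + t • v)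
    rw [sub_add_cancel_left, inner_neg_right, real_inner_smul_right] at h1
    nlinarith
  exact real_inner_self_nonpos.1 hle

theorem exists_forall_norm_le_expectedDist : ∃ R : ℝ, 0 < R ∧ ∀ x : H, R ≤ ‖x‖ →
    ‖x‖ / 2 ≤ expectedDist μ x := by
  have hlim : Tendsto (fun n : ℕ => ∫ z, min (‖z‖ * (1 / ((n : ℝ) + 1))) 1 ∂μ) atTop
      (𝓝 (∫ _, (0 : ℝ) ∂μ)) := by
    refine tendsto_integral_of_dominated_convergence (fun _ => 1) (fun n => by fun_prop)
      (integrable_const _) (fun n => Eventually.of_forall fun z => ?_)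
      (Eventually.of_forall fun z => ?_)
    · rw [Real.norm_of_nonneg (by positivity)]
      exact min_le_right _ _
    · have h := (tendsto_one_div_add_atTop_nhds_zero_nat (𝕜 := ℝ)).const_mul ‖z‖
      simpa using h.min (tendsto_const_nhds (x := (1 : ℝ)))
  rw [integral_zero] at hlim
  obtain ⟨n, hn⟩ := (hlim.eventually (gt_mem_nhds (show (0 : ℝ) < 1 / 4 by norm_num))).exists
  refine ⟨n + 1, by positivity, fun x hx => ?_⟩
  have hn1 : (0 : ℝ) < n + 1 := by positivity
  have hintegrable : Integrable (fun z : H => min (‖z‖ * (1 / ((n : ℝ) + 1))) 1) μ :=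
    Integrable.of_bound (by fun_prop) 1 (Eventually.of_forall fun z => by
      rw [Real.norm_of_nonneg (by positivity)]
      exact min_le_right _ _)
  have hle : ∫ z, ‖x‖ * (1 - 2 * min (‖z‖ * (1 / ((n : ℝ) + 1))) 1) ∂μ ≤ expectedDist μ x := by
    refine integral_mono (((integrable_const _).sub (hintegrable.const_mul 2)).const_mul _)
      (by simpa using integrable_norm_sub_sub_norm_sub μ x 0) fun z => ?_
    change ‖x‖ * (1 - 2 * min (‖z‖ * (1 / ((n : ℝ) + 1))) 1) ≤ ‖z - x‖ - ‖z‖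
    have h1 : ‖x‖ - ‖z‖ ≤ ‖z - x‖ := by rw [norm_sub_rev]; exact norm_sub_norm_le x z
    have h2 : ‖z‖ - ‖x‖ ≤ ‖z - x‖ := norm_sub_norm_le z x
    rcases min_cases (‖z‖ * (1 / ((n : ℝ) + 1))) 1 with ⟨h, -⟩ | ⟨h, -⟩
    · rw [h]
      have h3 : ‖z‖ ≤ ‖x‖ * (‖z‖ * (1 / ((n : ℝ) + 1))) := by
        rw [mul_one_div, ← mul_div_assoc, le_div_iff₀ hn1, mul_comm]
        gcongr
      linarith
    · rw [h]
      linarith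
  rw [integral_const_mul, integral_sub (integrable_const _) (hintegrable.const_mul 2),
    integral_const_mul] at hle
  simp only [integral_const, probReal_univ, smul_eq_mul, one_mul] at hle
  nlinarith [norm_nonneg x]

variable [CompleteSpace H]

/-- The expected distance is weakly lower semicontinuous. -/
theorem expectedDist_le_of_tendsto {x : ℕ → H} {a : H} {c : ℝ}
    (hx : ∀ y, Tendsto (fun n => ⟪x n, y⟫) atTop (𝓝 ⟪a, y⟫))
    (hc : Tendsto (fun n => expectedDist μ (x n)) atTop (𝓝 c)) : expectedDist μ a ≤ c := by
  have h : Tendsto (fun n => expectedDist μ (x n) + ⟪∫ z, gdir a z ∂μ, x n - a⟫) atTop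
      (𝓝 (c + 0)) := by
    refine hc.add ?_
    have := (hx (∫ z, gdir a z ∂μ)).sub_const ⟪a, ∫ z, gdir a z ∂μ⟫
    rw [sub_self] at this
    refine this.congr fun n => ?_
    rw [← inner_sub_left, real_inner_comm]
  rw [add_zero] at h
  exact ge_of_tendsto h (Eventually.of_forall fun n => expectedDist_le_add_inner μ a (x n))

/-- Spatial medians exist in separable Hilbert spaces. -/
theorem exists_forall_expectedDist_le : ∃ x, ∀ y, expectedDist μ x ≤ expectedDist μ y := by
  obtain ⟨R, hR, hcoer⟩ := exists_forall_norm_le_expectedDist μ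
  have hlow : ∀ x, -R ≤ expectedDist μ x := fun x => by
    rcases le_total R ‖x‖ with h | h
    · linarith [hcoer x h]
    · have h1 := expectedDist_le_add_inner μ 0 x
      have h2 : expectedDist μ 0 = 0 := by simp [expectedDist]
      have h3 : ‖∫ z, gdir 0 z ∂μ‖ ≤ 1 := by
        simpa using norm_integral_le_of_norm_le_const (μ := μ)
          (Eventually.of_forall fun z : H => norm_gdir_le 0 z)
      have h4 := real_inner_le_norm (∫ z, gdir 0 z ∂μ) (x - 0)
      have h5 : ‖∫ z, gdir 0 z ∂μ‖ * ‖x - 0‖ ≤ 1 * R := by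
        rw [sub_zero]; gcongr
      linarith
  have hbdd : BddBelow (Set.range (expectedDist μ)) := ⟨-R, by rintro _ ⟨x, rfl⟩; exact hlow x⟩
  obtain ⟨u, -, hu, hmem⟩ := exists_seq_tendsto_sInf (Set.range_nonempty (expectedDist μ)) hbdd
  choose x hx using hmem
  have hx : (fun n => expectedDist μ (x n)) = u := funext hx
  have hubdd : ∃ C, ∀ n, u n ≤ C := by
    obtain ⟨C, hC⟩ := hu.bddAbove_range
    exact ⟨C, fun n => hC ⟨n, rfl⟩⟩
  obtain ⟨C, hC⟩ := hubdd
  have hxb : ∀ n, ‖x n‖ ≤ max R (2 * C) := fun n => by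
    rcases le_total R ‖x n‖ with h | h
    · have := hcoer _ h
      have h2 := hC n
      rw [← hx] at h2
      exact le_max_of_le_right (by linarith)
    · exact le_max_of_le_left h
  obtain ⟨a, φ, hφ, ha⟩ := exists_subseq_tendsto_inner hxb
  refine ⟨a, fun y => (expectedDist_le_of_tendsto μ ha (c := sInf (Set.range (expectedDist μ)))
    ?_).trans (csInf_le hbdd ⟨y, rfl⟩)⟩
  rw [← hx] at hu
  exact hu.comp hφ.tendsto_atTop

/-- Weak convergence together with convergence of the expected distance gives strong convergence
along a subsequence. -/
theorem exists_subseq_tendsto_of_tendsto_expectedDist {x : ℕ → H} {a : H}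
    (hx : ∀ y, Tendsto (fun n => ⟪x n, y⟫) atTop (𝓝 ⟪a, y⟫))
    (hc : Tendsto (fun n => expectedDist μ (x n)) atTop (𝓝 (expectedDist μ a))) :
    ∃ φ : ℕ → ℕ, StrictMono φ ∧ Tendsto (fun n => x (φ n)) atTop (𝓝 a) := by
  have hx0 : ∀ y, Tendsto (fun n => ⟪y, x n - a⟫) atTop (𝓝 0) := fun y => by
    have := (hx y).sub_const ⟪a, y⟫
    rw [sub_self] at this
    refine this.congr fun n => ?_
    rw [← inner_sub_left, real_inner_comm]
  let h : ℕ → H → ℝ := fun n z => ‖z - x n‖ - ‖z - a‖ + ⟪gdir a z, x n - a⟫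
  have hpos : ∀ n z, 0 ≤ h n z := fun n z => by
    have := norm_sub_le_norm_sub_add_inner_gdir a (x n) z
    simp only [h]
    linarith
  have hintegrable : ∀ n, Integrable (h n) μ := fun n =>
    (integrable_norm_sub_sub_norm_sub μ _ _).add ((integrable_gdir μ a).inner_const _)
  have hval : ∀ n, ∫ z, h n z ∂μ =
      expectedDist μ (x n) - expectedDist μ a + ⟪∫ z, gdir a z ∂μ, x n - a⟫ := fun n => by
    rw [expectedDist_sub, ← integral_inner_gdir]
    exact integral_add (integrable_norm_sub_sub_norm_sub μ _ _)
      ((integrable_gdir μ a).inner_const _)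
  have hlim : Tendsto (fun n => ∫ z, h n z ∂μ) atTop (𝓝 0) := by
    have := (hc.sub_const (expectedDist μ a)).add (hx0 (∫ z, gdir a z ∂μ))
    simpa [hval] using this
  have hmeas : TendstoInMeasure μ h atTop (fun _ => (0 : ℝ)) := by
    refine tendstoInMeasure_of_tendsto_eLpNorm one_ne_zero
      (fun n => (hintegrable n).aestronglyMeasurable) aestronglyMeasurable_const ?_
    have he : ∀ n, eLpNorm (h n - fun _ => (0 : ℝ)) 1 μ = ENNReal.ofReal (∫ z, h n z ∂μ) :=
      fun n => by
        have h0 : (h n - fun _ => (0 : ℝ)) = h n := by ext; simp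
        rw [h0, eLpNorm_one_eq_lintegral_enorm, ← ofReal_integral_norm_eq_lintegral_enorm (hintegrable n)]
        congr 1
        exact integral_congr_ae (Eventually.of_forall fun z => Real.norm_of_nonneg (hpos n z))
    simp_rw [he]
    simpa using ENNReal.tendsto_ofReal hlim
  obtain ⟨φ, hφ, hae⟩ := hmeas.exists_seq_tendsto_ae
  obtain ⟨z, hz⟩ := hae.exists
  refine ⟨φ, hφ, ?_⟩
  have hnorm : Tendsto (fun n => ‖z - x (φ n)‖) atTop (𝓝 ‖z - a‖) := by
    have := (hz.sub ((hx0 (gdir a z)).comp hφ.tendsto_atTop)).add_const ‖z - a‖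
    simp only [sub_zero, zero_add] at this
    refine this.congr fun n => ?_
    simp only [h, Function.comp]
    ring
  have hsq : Tendsto (fun n => ‖x (φ n) - a‖ ^ 2) atTop (𝓝 0) := by
    have := ((hnorm.pow 2).sub_const (‖z - a‖ ^ 2)).add
      (((hx0 (z - a)).comp hφ.tendsto_atTop).const_mul 2)
    simp only [sub_self, mul_zero, add_zero] at this
    refine this.congr fun n => ?_
    have hsub : z - x (φ n) = (z - a) - (x (φ n) - a) := by abel
    simp only [Function.comp]
    rw [hsub, norm_sub_sq_real]
    ring
  rw [tendsto_iff_norm_sub_tendsto_zero]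
  have := hsq.sqrt
  simpa using this

/-- A unique spatial median is a well-separated minimizer of the expected distance. -/
theorem exists_forall_norm_sub_eq_add_le_expectedDist {a : H}
    (hmin : ∀ y, expectedDist μ a ≤ expectedDist μ y)
    (huniq : ∀ y, (∀ w, expectedDist μ y ≤ expectedDist μ w) → y = a) {ε : ℝ} (hε : 0 < ε) :
    ∃ η : ℝ, 0 < η ∧ ∀ y, ‖y - a‖ = ε → expectedDist μ a + η ≤ expectedDist μ y := by
  by_contra! hcon
  choose x hxε hxlt using fun n : ℕ => hcon (1 / ((n : ℝ) + 1)) (by positivity)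
  have hlim : Tendsto (fun n => expectedDist μ (x n)) atTop (𝓝 (expectedDist μ a)) := by
    refine tendsto_of_tendsto_of_tendsto_of_le_of_le tendsto_const_nhds ?_ (fun n => hmin (x n))
      (fun n => (hxlt n).le)
    simpa using (tendsto_one_div_add_atTop_nhds_zero_nat (𝕜 := ℝ)).const_add (expectedDist μ a)
  have hxb : ∀ n, ‖x n‖ ≤ ε + ‖a‖ := fun n => by
    have := norm_add_le (x n - a) a
    rwa [sub_add_cancel, hxε] at this
  obtain ⟨b, φ, hφ, hb⟩ := exists_subseq_tendsto_inner hxb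
  have hlimφ := hlim.comp hφ.tendsto_atTop
  obtain rfl : b = a := huniq b fun w => (expectedDist_le_of_tendsto μ hb hlimφ).trans (hmin w)
  obtain ⟨ψ, -, hψ⟩ := exists_subseq_tendsto_of_tendsto_expectedDist μ hb hlimφ
  have := tendsto_iff_norm_sub_tendsto_zero.1 hψ
  simp only [hxε] at this
  exact hε.ne' (tendsto_nhds_unique tendsto_const_nhds this)

/-- For a measure not charging spheres, a unique minimizer of the norm of the mean direction is
the unique spatial median. -/
theorem expectedDist_le_of_forall_norm_integral_gdir_lt [Nontrivial H]
    (hμ : ∀ (y : H) (r : ℝ), 0 < r → μ {z | ‖z - y‖ = r} = 0) {θ : H}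
    (hθ : ∀ x, x ≠ θ → ‖∫ z, gdir θ z ∂μ‖ < ‖∫ z, gdir x z ∂μ‖) :
    (∀ y, expectedDist μ θ ≤ expectedDist μ y) ∧
      ∀ y, (∀ w, expectedDist μ y ≤ expectedDist μ w) → y = θ := by
  have huniq : ∀ y, (∀ w, expectedDist μ y ≤ expectedDist μ w) → y = θ := fun y hy => by
    by_contra hne
    have := hθ y hne
    rw [integral_gdir_eq_zero_of_forall_expectedDist_le μ
      (measure_singleton_eq_zero_of_measure_sphere hμ y) hy, norm_zero] at this
    exact (norm_nonneg _).not_gt this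
  obtain ⟨m, hm⟩ := exists_forall_expectedDist_le μ
  exact ⟨huniq m hm ▸ hm, huniq⟩

end Median

theorem stmt2 {H : Type*} [NormedAddCommGroup H] [InnerProductSpace ℝ H]
    [CompleteSpace H] [SecondCountableTopology H] [MeasurableSpace H] [BorelSpace H]
    (Q : ProbabilityMeasure H)
    (hH1Q : ∀ (y : H) (r : ℝ), 0 < r → (Q : Measure H) {z | ‖z - y‖ = r} = 0)
    (θQ : H)
    (hminQ : ∀ x : H, x ≠ θQ →
      ‖∫ z, gdir θQ z ∂(Q : Measure H)‖ < ‖∫ z, gdir x z ∂(Q : Measure H)‖) :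
    ∀ ε : ℝ, 0 < ε → ∃ δ : ℝ, 0 < δ ∧
      ∀ (Q' : ProbabilityMeasure H) (θQ' : H),
        (∀ (y : H) (r : ℝ), 0 < r → (Q' : Measure H) {z | ‖z - y‖ = r} = 0) →
        (∀ x : H, x ≠ θQ' →
          ‖∫ z, gdir θQ' z ∂(Q' : Measure H)‖ < ‖∫ z, gdir x z ∂(Q' : Measure H)‖) →
        levyProkhorovDist (Q : Measure H) (Q' : Measure H) < δ →
        ‖θQ' - θQ‖ < ε := by
  intro ε hε
  rcases subsingleton_or_nontrivial H with hH | hH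
  · refine ⟨1, one_pos, fun Q' θQ' _ _ _ => ?_⟩
    rw [Subsingleton.elim θQ' θQ, sub_self, norm_zero]
    exact hε
  obtain ⟨hmin, huniq⟩ := expectedDist_le_of_forall_norm_integral_gdir_lt (Q : Measure H) hH1Q hminQ
  obtain ⟨η, hη, hsep⟩ :=
    exists_forall_norm_sub_eq_add_le_expectedDist (Q : Measure H) hmin huniq hε
  refine ⟨η / (2 * (2 + 2 * ε)), by positivity, fun Q' θ' hH1Q' hminQ' hdist => ?_⟩
  obtain ⟨hmin', -⟩ :=
    expectedDist_le_of_forall_norm_integral_gdir_lt (Q' : Measure H) hH1Q' hminQ'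
  by_contra! hfar
  have hpos : 0 < ‖θ' - θQ‖ := hε.trans_le hfar
  set y := θQ + (ε / ‖θ' - θQ‖) • (θ' - θQ) with hy
  have hyε : ‖y - θQ‖ = ε := by
    rw [hy, add_sub_cancel_left, norm_smul, Real.norm_of_nonneg (by positivity),
      div_mul_cancel₀ _ hpos.ne']
  have hyQ' : expectedDist (Q' : Measure H) y - expectedDist (Q' : Measure H) θQ ≤ 0 :=
    (expectedDist_lineMap_le (Q' : Measure H) θQ θ' (by positivity)
      ((div_le_one hpos).2 hfar)).trans
      (mul_nonpos_of_nonneg_of_nonpos (by positivity) (sub_nonpos.2 (hmin' θQ)))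
  have hyQ := hsep y hyε
  have habs := fun z => abs_le.1 (hyε ▸ abs_norm_sub_sub_norm_sub_le y θQ z)
  have hLP := integral_le_integral_add_of_levyProkhorovDist_lt (Q : Measure H) (Q' : Measure H)
    (K := 2) (M := 2 * ε) zero_le_two hdist (fun z => ‖z - y‖ - ‖z - θQ‖ + ε)
    (fun z => by linarith [(habs z).1]) (fun z => by linarith [(habs z).2]) (by fun_prop)
    (fun z w => by
      have h1 := norm_sub_le_norm_sub_add_norm_sub z w y
      have h2 := norm_sub_le_norm_sub_add_norm_sub w z θQ
      rw [norm_sub_rev w z] at h2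
      rw [dist_eq_norm]
      linarith)
  have hval : ∀ P : ProbabilityMeasure H, ∫ z, (‖z - y‖ - ‖z - θQ‖ + ε) ∂(P : Measure H) =
      expectedDist (P : Measure H) y - expectedDist (P : Measure H) θQ + ε := fun P => by
    rw [expectedDist_sub, integral_add (integrable_norm_sub_sub_norm_sub (P : Measure H) y θQ)
      (integrable_const ε)]
    simp
  rw [hval, hval] at hLP
  have hδ : (2 + 2 * ε) * (η / (2 * (2 + 2 * ε))) = η / 2 := by field_simp
  linarith
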